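/- Let K be a kernel function, let 0 < α < a < b < β < 1, p, q > 0, and set μ := p(a−α)/(q(β−b)). If K is monotone (M) and μ ≥ 1, then for every t ∈ [0,α] one has p·K(t−α) + q·K(t−β) ≤ p·K(t−a) + q·K(t−b) (inequality in ℝ ∪ {−∞}). If in addition K is strictly concave, the inequality is strict for every t ∈ [0,α]. -/

import Mathlib

open Set Filter

noncomputable section

/-- A kernel function: `ℝ ∪ {−∞}`-valued (modeled as `EReal`, never `⊤`),
finite and concave on `(-1,0)` and `(0,1)`, extended continuously to `[-1,1]`. -/
structure IsKernel (K : ℝ → EReal) : Prop where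
  ne_top : ∀ t, K t ≠ ⊤
  finite_off_zero : ∀ t ∈ Ioo (-1:ℝ) 1, t ≠ 0 → K t ≠ ⊥
  concave_neg : ConcaveOn ℝ (Ioo (-1:ℝ) 0) (fun t => (K t).toReal)
  concave_pos : ConcaveOn ℝ (Ioo (0:ℝ) 1) (fun t => (K t).toReal)
  lim_zero_left : Tendsto K (nhdsWithin 0 (Iio 0)) (nhds (K 0))
  lim_zero_right : Tendsto K (nhdsWithin 0 (Ioi 0)) (nhds (K 0))
  lim_neg_one : Tendsto K (nhdsWithin (-1) (Ioi (-1))) (nhds (K (-1)))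
  lim_one : Tendsto K (nhdsWithin 1 (Iio 1)) (nhds (K 1))

/-- Singularity condition `(∞)`: `K(0) = −∞`. -/
def SingularKernel (K : ℝ → EReal) : Prop := K 0 = ⊥

/-- Monotonicity condition (M). -/
def MonotoneKernel (K : ℝ → EReal) : Prop :=
  AntitoneOn K (Ioo (-1:ℝ) 0) ∧ MonotoneOn K (Ioo (0:ℝ) 1)

/-- Strict monotonicity condition (SM). -/
def StrictMonotoneKernel (K : ℝ → EReal) : Prop :=
  StrictAntiOn K (Ico (-1:ℝ) 0) ∧ StrictMonoOn K (Ioc (0:ℝ) 1)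

/-- Strict concavity of a kernel function. -/
def StrictConcaveKernel (K : ℝ → EReal) : Prop :=
  StrictConcaveOn ℝ (Ioo (-1:ℝ) 0) (fun t => (K t).toReal) ∧
  StrictConcaveOn ℝ (Ioo (0:ℝ) 1) (fun t => (K t).toReal)

/-- An `n`-field function: bounded above, never `+∞`, finite on a set of weighted
cardinality exceeding `n` (interior points of `[0,1]` count `1`, the endpoints `1/2`). -/
def IsFieldFn (n : ℕ) (J : ℝ → EReal) : Prop :=
  (∀ t, J t ≠ ⊤) ∧ (∃ M : ℝ, ∀ t ∈ Icc (0:ℝ) 1, J t ≤ (M : EReal)) ∧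
  ∃ T : Finset ℝ, (T : Set ℝ) ⊆ Icc (0:ℝ) 1 ∧ (∀ t ∈ T, J t ≠ ⊥) ∧
    (n : ℝ) < ∑ t ∈ T, (if t = 0 ∨ t = 1 then (1/2 : ℝ) else 1)

/-- The closed simplex `S̄`. -/
def closedSimplex (n : ℕ) : Set (Fin n → ℝ) :=
  {y | Monotone y ∧ ∀ j, y j ∈ Icc (0:ℝ) 1}

/-- The open simplex `S`. -/
def openSimplex (n : ℕ) : Set (Fin n → ℝ) :=
  {y | StrictMono y ∧ ∀ j, y j ∈ Ioo (0:ℝ) 1}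

/-- Extended nodes: `y₀ = 0`, `y_{n+1} = 1`. -/
def extNode {n : ℕ} (y : Fin n → ℝ) (j : Fin (n + 2)) : ℝ :=
  if _h0 : (j : ℕ) = 0 then 0
  else if _hn : (j : ℕ) ≤ n then y ⟨(j : ℕ) - 1, by omega⟩
  else 1

/-- The interval `I_j(y) = [y_j, y_{j+1}]`, `j = 0, …, n`. -/
def nodeInterval {n : ℕ} (y : Fin n → ℝ) (j : Fin (n + 1)) : Set ℝ :=
  Icc (extNode y j.castSucc) (extNode y j.succ)

/-- The sum of translates function `F(y,t) = J(t) + ∑ⱼ rⱼ K(t - yⱼ)`. -/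
def sumTrans {n : ℕ} (r : Fin n → ℝ) (K J : ℝ → EReal) (y : Fin n → ℝ) (t : ℝ) : EReal :=
  J t + ∑ j, (r j : EReal) * K (t - y j)

/-- The interval maximum `m_j(y) = sup_{t ∈ I_j(y)} F(y,t)`. -/
def mj {n : ℕ} (r : Fin n → ℝ) (K J : ℝ → EReal) (j : Fin (n + 1)) (y : Fin n → ℝ) : EReal :=
  sSup (sumTrans r K J y '' nodeInterval y j)

/-- `m̄(y) = max_j m_j(y)`. -/
def mbar {n : ℕ} (r : Fin n → ℝ) (K J : ℝ → EReal) (y : Fin n → ℝ) : EReal :=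
  ⨆ j, mj r K J j y

/-- `m̲(y) = min_j m_j(y)`. -/
def munder {n : ℕ} (r : Fin n → ℝ) (K J : ℝ → EReal) (y : Fin n → ℝ) : EReal :=
  ⨅ j, mj r K J j y

/-- The regularity set `Y`. -/
def regSet {n : ℕ} (r : Fin n → ℝ) (K J : ℝ → EReal) : Set (Fin n → ℝ) :=
  {y ∈ openSimplex n | ∀ j, mj r K J j y ≠ ⊥}

/-- Equioscillation: all interval maxima agree. -/
def Equioscillation {n : ℕ} (r : Fin n → ℝ) (K J : ℝ → EReal) (y : Fin n → ℝ) : Prop :=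
  ∀ i j : Fin (n + 1), mj r K J i y = mj r K J j y

lemma ConcaveOn.sub_mul_sub_le {s : Set ℝ} {f : ℝ → ℝ} (hf : ConcaveOn ℝ s f) {x y z : ℝ}
    (hx : x ∈ s) (hz : z ∈ s) (hxy : x < y) (hyz : y < z) :
    (f z - f y) * (y - x) ≤ (f y - f x) * (z - y) :=
  (div_le_div_iff₀ (sub_pos.2 hyz) (sub_pos.2 hxy)).1 (hf.slope_anti_adjacent hx hz hxy hyz)

lemma StrictConcaveOn.sub_mul_sub_lt {s : Set ℝ} {f : ℝ → ℝ} (hf : StrictConcaveOn ℝ s f)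
    {x y z : ℝ} (hx : x ∈ s) (hz : z ∈ s) (hxy : x < y) (hyz : y < z) :
    (f z - f y) * (y - x) < (f y - f x) * (z - y) :=
  (div_lt_div_iff₀ (sub_pos.2 hyz) (sub_pos.2 hxy)).1 (hf.slope_anti_adjacent hx hz hxy hyz)

lemma IsKernel.coe_toReal {K : ℝ → EReal} (hK : IsKernel K) {t : ℝ} (ht : t ∈ Ioo (-1 : ℝ) 0) :
    ((K t).toReal : EReal) = K t :=
  EReal.coe_toReal (hK.ne_top t) (hK.finite_off_zero t ⟨ht.1, ht.2.trans one_pos⟩ ht.2.ne)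

lemma IsKernel.antitoneOn_toReal {K : ℝ → EReal} (hK : IsKernel K) (hM : MonotoneKernel K) :
    AntitoneOn (fun t => (K t).toReal) (Ioo (-1 : ℝ) 0) := fun x hx y hy hxy =>
  EReal.toReal_le_toReal (hM.1 hx hy hxy)
    (hK.finite_off_zero y ⟨hy.1, hy.2.trans one_pos⟩ hy.2.ne) (hK.ne_top x)

/-- The three-slope inequality extends to a right endpoint `w = 0`
where the kernel is finite. -/
lemma IsKernel.toReal_sub_mul_sub_le {K : ℝ → EReal} (hK : IsKernel K)
    {y z w : ℝ} (hy : -1 < y) (hyz : y < z) (hzw : z < w) (hw : w ≤ 0)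
    (hKw : K w ≠ ⊥) :
    ((K w).toReal - (K z).toReal) * (z - y) ≤ ((K z).toReal - (K y).toReal) * (w - z) := by
  have hyI : y ∈ Ioo (-1 : ℝ) 0 := ⟨hy, by linarith⟩
  have hzI : z ∈ Ioo (-1 : ℝ) 0 := ⟨by linarith, by linarith⟩
  have interior : ∀ v ∈ Ioo z 0,
      ((K v).toReal - (K z).toReal) * (z - y) ≤ ((K z).toReal - (K y).toReal) * (v - z) := by
    intro v hv
    have hvI : v ∈ Ioo (-1 : ℝ) 0 := ⟨hzI.1.trans hv.1, hv.2⟩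
    exact hK.concave_neg.sub_mul_sub_le hyI hvI hyz hv.1
  rcases hw.lt_or_eq with hw | rfl
  · exact interior w ⟨hzw, hw⟩
  have hlim : Tendsto (fun v => (K v).toReal) (nhdsWithin 0 (Iio 0)) (nhds (K 0).toReal) :=
    (EReal.tendsto_toReal (hK.ne_top 0) hKw).comp hK.lim_zero_left
  have hid : Tendsto (fun v : ℝ => v) (nhdsWithin 0 (Iio 0)) (nhds 0) :=
    tendsto_id.mono_left nhdsWithin_le_nhds
  have hev : ∀ᶠ v in nhdsWithin (0 : ℝ) (Iio 0), v ∈ Ioo z 0 := Ioo_mem_nhdsLT hzw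
  exact le_of_tendsto_of_tendsto ((hlim.sub_const _).mul_const _)
    ((hid.sub_const _).const_mul _) (hev.mono interior)

theorem statement2 (K : ℝ → EReal) (hK : IsKernel K) (hM : MonotoneKernel K)
    (α a b β : ℝ) (h0 : 0 < α) (h1 : α < a) (h2 : a < b) (h3 : b < β) (h4 : β < 1)
    (p q : ℝ) (hp : 0 < p) (hq : 0 < q)
    (hμ : 1 ≤ p * (a - α) / (q * (β - b))) :
    (∀ t ∈ Icc (0:ℝ) α,
      (p : EReal) * K (t - α) + (q : EReal) * K (t - β) ≤
        (p : EReal) * K (t - a) + (q : EReal) * K (t - b)) ∧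
    (StrictConcaveKernel K → ∀ t ∈ Icc (0:ℝ) α,
      (p : EReal) * K (t - α) + (q : EReal) * K (t - β) <
        (p : EReal) * K (t - a) + (q : EReal) * K (t - b)) := by
  have hμ' : q * (β - b) ≤ p * (a - α) := by
    rwa [one_le_div (mul_pos hq (sub_pos.2 h3))] at hμ
  have key : ∀ t ∈ Icc (0 : ℝ) α,
      (p : EReal) * K (t - α) + (q : EReal) * K (t - β) ≤
        (p : EReal) * K (t - a) + (q : EReal) * K (t - b) ∧
      (StrictConcaveKernel K → (p : EReal) * K (t - α) + (q : EReal) * K (t - β) <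
        (p : EReal) * K (t - a) + (q : EReal) * K (t - b)) := by
    rintro t ⟨ht0, htα⟩
    have hx : t - β ∈ Ioo (-1 : ℝ) 0 := ⟨by linarith, by linarith⟩
    have hy : t - b ∈ Ioo (-1 : ℝ) 0 := ⟨by linarith, by linarith⟩
    have hz : t - a ∈ Ioo (-1 : ℝ) 0 := ⟨by linarith, by linarith⟩
    have hxy : t - β < t - b := by linarith
    have hyz : t - b < t - a := by linarith
    rw [← hK.coe_toReal hx, ← hK.coe_toReal hy, ← hK.coe_toReal hz]
    by_cases hw : K (t - α) = ⊥
    · rw [hw, EReal.coe_mul_bot_of_pos hp, EReal.bot_add]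
      exact ⟨bot_le, fun _ => by exact_mod_cast EReal.bot_lt_coe _⟩
    have hslope :=
      hK.toReal_sub_mul_sub_le hy.1 hyz (by linarith : t - a < t - α) (by linarith) hw
    have hzy := hK.antitoneOn_toReal hM hy hz hyz.le
    rw [← EReal.coe_toReal (hK.ne_top (t - α)) hw]
    norm_cast
    have hc := hK.concave_neg.sub_mul_sub_le hx hz hxy hyz
    have hs := fun hS : StrictConcaveKernel K => hS.1.sub_mul_sub_lt hx hz hxy hyz
    simp only [sub_sub_sub_cancel_left] at hslope hc hs hzy
    generalize (K (t - α)).toReal = fw at *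
    generalize (K (t - a)).toReal = fz at *
    generalize (K (t - b)).toReal = fy at *
    generalize (K (t - β)).toReal = fx at *
    have hpw := mul_le_mul_of_nonneg_left hslope hp.le
    have hyzμ := mul_le_mul_of_nonneg_left hμ' (sub_nonneg.2 hzy)
    constructor
    · have hqx := mul_le_mul_of_nonneg_left hc hq.le
      refine le_of_mul_le_mul_right ?_ (sub_pos.2 h2)
      linarith
    · intro hS
      have hqx := mul_lt_mul_of_pos_left (hs hS) hq
      refine lt_of_mul_lt_mul_right ?_ (sub_pos.2 h2).le
      linarith
  exact ⟨fun t ht => (key t ht).1, fun hS t ht => (key t ht).2 hS⟩
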